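/- Let C ⊆ ℝ^m (m ≥ 2) be a convex set of probability vectors, let φ* ∈ C maximize H over C, set H* = H(φ*), and let 0 < θ ≤ 1/2. Then for every integer n ≥ 100, the sum of #f over all f ∈ F_n ∩ C with ‖f − φ*‖₁ > θ is strictly less than 4.004·√(2π)·0.6^m·n^{(m−1)/2}·e^{n(H* − θ²/2)}. -/

import Mathlib

open scoped Classical
open BigOperators Finset

lemma log_aux_deriv (x : ℝ) (hx : 0 < x) :
    HasDerivAt (fun x : ℝ => Real.log x - (x - 1) * (5 * x + 1) / (2 * x * (x + 2)))
      ((x - 1) ^ 3 / (x ^ 2 * (x + 2) ^ 2)) x := by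
  have h1 : HasDerivAt (fun x : ℝ => (x - 1) * (5 * x + 1)) (1 * (5 * x + 1) + (x - 1) * (5 * 1)) x :=
    ((hasDerivAt_id x).sub_const 1).mul (((hasDerivAt_id x).const_mul 5).add_const 1)
  have h2 : HasDerivAt (fun x : ℝ => 2 * x * (x + 2)) (2 * 1 * (x + 2) + 2 * x * 1) x :=
    ((hasDerivAt_id x).const_mul 2).mul ((hasDerivAt_id x).add_const 2)
  have hne : 2 * x * (x + 2) ≠ 0 := by positivity
  have h := (Real.hasDerivAt_log hx.ne').sub (h1.div h2 hne)
  refine h.congr_deriv ?_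
  have : x + 2 ≠ 0 := by positivity
  field_simp
  ring

lemma log_aux (x : ℝ) (hx : 0 < x) :
    (x - 1) * (5 * x + 1) / (2 * x * (x + 2)) ≤ Real.log x := by
  set g : ℝ → ℝ := fun x : ℝ => Real.log x - (x - 1) * (5 * x + 1) / (2 * x * (x + 2)) with hg
  have hd : ∀ y, 0 < y → HasDerivAt g ((y - 1) ^ 3 / (y ^ 2 * (y + 2) ^ 2)) y := log_aux_deriv
  have g1 : g 1 = 0 := by simp [hg]
  suffices g 1 ≤ g x by rw [g1] at this; simp only [hg] at this; linarith
  rcases le_total x 1 with h | h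
  · have : AntitoneOn g (Set.Icc x 1) := by
      apply antitoneOn_of_deriv_nonpos (convex_Icc x 1)
      · intro y hy; exact (hd y (hx.trans_le hy.1)).continuousAt.continuousWithinAt
      · intro y hy; rw [interior_Icc] at hy
        exact (hd y (hx.trans hy.1)).differentiableAt.differentiableWithinAt
      · intro y hy; rw [interior_Icc] at hy
        rw [(hd y (hx.trans hy.1)).deriv]
        apply div_nonpos_of_nonpos_of_nonneg _ (by positivity)
        have : 0 ≤ (1 - y) ^ 3 := pow_nonneg (by linarith [hy.2]) 3
        linarith [show (y - 1) ^ 3 = - (1 - y) ^ 3 by ring]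
    exact this ⟨le_rfl, h⟩ ⟨h, le_rfl⟩ h
  · have : MonotoneOn g (Set.Icc 1 x) := by
      apply monotoneOn_of_deriv_nonneg (convex_Icc 1 x)
      · intro y hy; exact (hd y (one_pos.trans_le hy.1)).continuousAt.continuousWithinAt
      · intro y hy; rw [interior_Icc] at hy
        exact (hd y (one_pos.trans hy.1)).differentiableAt.differentiableWithinAt
      · intro y hy; rw [interior_Icc] at hy
        rw [(hd y (one_pos.trans hy.1)).deriv]
        have : 0 ≤ (y - 1) ^ 3 := pow_nonneg (by linarith [hy.1]) 3
        positivity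
    exact this ⟨le_rfl, h⟩ ⟨h, le_rfl⟩ h

lemma pinsker_term (p q : ℝ) (hp : 0 ≤ p) (hq : 0 < q) :
    3 * (p - q) ^ 2 / (2 * (p + 2 * q)) ≤ p * Real.log p - p * Real.log q - p + q := by
  rcases hp.eq_or_lt with rfl | hp
  · simp only [zero_mul]
    rw [div_le_iff₀ (by positivity)]; nlinarith
  have h := log_aux (p / q) (by positivity)
  rw [Real.log_div hp.ne' hq.ne'] at h
  have h2 := mul_le_mul_of_nonneg_left h hp.le
  have e : p * ((p / q - 1) * (5 * (p / q) + 1) / (2 * (p / q) * (p / q + 2)))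
      = 3 * (p - q) ^ 2 / (2 * (p + 2 * q)) + p - q := by
    have : p + 2 * q ≠ 0 := by positivity
    field_simp
    ring
  rw [e] at h2
  linarith

lemma pinsker {m : ℕ} (p q : Fin m → ℝ) (hp : ∀ i, 0 ≤ p i) (hq : ∀ i, 0 ≤ q i)
    (hp1 : ∑ i, p i = 1) (hq1 : ∑ i, q i = 1) (hac : ∀ i, q i = 0 → p i = 0) :
    (∑ i, |p i - q i|) ^ 2 / 2 ≤ ∑ i, p i * Real.log (p i) - ∑ i, p i * Real.log (q i) := by
  have key : ∀ i, 0 ≤ p i * Real.log (p i) - p i * Real.log (q i) - p i + q i ∧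
      |p i - q i| ^ 2 ≤ (2 * p i + 4 * q i) / 3 *
        (p i * Real.log (p i) - p i * Real.log (q i) - p i + q i) := by
    intro i
    rcases (hq i).eq_or_lt with h | h
    · simp [← h, hac i h.symm]
    have hi := hp i
    have := pinsker_term (p i) (q i) (hp i) h
    refine ⟨le_trans (by positivity) this, ?_⟩
    rw [div_le_iff₀ (by positivity)] at this
    rw [sq_abs]; linarith
  have := sum_sq_le_sum_mul_sum_of_sq_le_mul univ (r := fun i => |p i - q i|)
    (f := fun i => (2 * p i + 4 * q i) / 3)
    (g := fun i => p i * Real.log (p i) - p i * Real.log (q i) - p i + q i)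
    (fun i _ => by have := hp i; have := hq i; positivity) (fun i _ => (key i).1)
    (fun i _ => (key i).2)
  rw [← Finset.sum_div, sum_add_distrib, sum_add_distrib, sum_sub_distrib, sum_sub_distrib,
    ← mul_sum, ← mul_sum, hp1, hq1] at this
  linarith

lemma entropy_gap {m : ℕ} (C : Set (Fin m → ℝ))
    (hCprob : ∀ x ∈ C, (∀ i, 0 ≤ x i) ∧ ∑ i, x i = 1)
    (hCconv : Convex ℝ C)
    (φ : Fin m → ℝ) (hφC : φ ∈ C)
    (hφmax : ∀ x ∈ C, -∑ i, x i * Real.log (x i) ≤ -∑ i, φ i * Real.log (φ i))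
    (f : Fin m → ℝ) (hf : f ∈ C) :
    (∑ i, |f i - φ i|) ^ 2 / 2 ≤ -∑ i, φ i * Real.log (φ i) + ∑ i, f i * Real.log (f i) := by
  set D := ∑ i, |f i - φ i| with hD
  obtain ⟨hf0, hf1⟩ := hCprob f hf
  obtain ⟨hφ0, hφ1⟩ := hCprob φ hφC
  have main : ∀ t : ℝ, 0 < t → t < 1 → ((1 - t) * D) ^ 2 / 2 ≤
      -∑ i, φ i * Real.log (φ i) + ∑ i, f i * Real.log (f i) := by
    intro t ht0 ht1
    have hx : (1 - t) • φ + t • f ∈ C := hCconv hφC hf (by linarith) ht0.le (by ring)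
    obtain ⟨x, hxe⟩ : ∃ x, x = (1 - t) • φ + t • f := ⟨_, rfl⟩
    rw [← hxe] at hx
    have hxi : ∀ i, x i = (1 - t) * φ i + t * f i := by intro i; simp [hxe]
    obtain ⟨hx0, hx1⟩ := hCprob x hx
    have hs : 0 < 1 - t := by linarith
    have z : ∀ i, x i = 0 → φ i = 0 ∧ f i = 0 := by
      intro i hi
      rw [hxi] at hi
      have a := mul_nonneg hs.le (hφ0 i)
      have b := mul_nonneg ht0.le (hf0 i)
      constructor
      · have : (1 - t) * φ i = 0 := by linarith
        simpa [hs.ne'] using this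
      · have : t * f i = 0 := by linarith
        simpa [ht0.ne'] using this
    have P1 := pinsker f x hf0 hx0 hf1 hx1 (fun i hi => (z i hi).2)
    have P2 := pinsker φ x hφ0 hx0 hφ1 hx1 (fun i hi => (z i hi).1)
    have P2' : 0 ≤ (∑ i, |φ i - x i|) ^ 2 / 2 := by positivity
    have hm := hφmax x hx
    have e : ∑ i, x i * Real.log (x i) =
        (1 - t) * ∑ i, φ i * Real.log (x i) + t * ∑ i, f i * Real.log (x i) := by
      rw [mul_sum, mul_sum, ← sum_add_distrib]
      refine sum_congr rfl fun i _ => ?_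
      nth_rw 1 [hxi i]; ring
    have e2 : ∑ i, |f i - x i| = (1 - t) * D := by
      rw [hD, mul_sum]
      refine sum_congr rfl fun i _ => ?_
      rw [hxi, show f i - ((1 - t) * φ i + t * f i) = (1 - t) * (f i - φ i) by ring, abs_mul,
        abs_of_pos hs]
    rw [e2] at P1
    have P3 : ∑ i, φ i * Real.log (x i) ≤ ∑ i, φ i * Real.log (φ i) := by linarith
    have P4 := mul_le_mul_of_nonneg_left P3 hs.le
    have : t * (∑ i, φ i * Real.log (φ i)) ≤ t * ∑ i, f i * Real.log (x i) := by linarith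
    have := le_of_mul_le_mul_left this ht0
    linarith
  have hc : Filter.Tendsto (fun t : ℝ => ((1 - t) * D) ^ 2 / 2) (nhdsWithin 0 (Set.Ioi 0))
      (nhds (D ^ 2 / 2)) := by
    have : Continuous (fun t : ℝ => ((1 - t) * D) ^ 2 / 2) := by fun_prop
    have := (this.tendsto 0).mono_left (nhdsWithin_le_nhds (s := Set.Ioi 0))
    simpa using this
  refine le_of_tendsto hc ?_
  filter_upwards [Ioo_mem_nhdsGT (one_pos : (0:ℝ) < 1)] with t ht
  exact main t ht.1 ht.2

lemma choose_swap (n j k : ℕ) :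
    n.choose k * (n - k).choose j = n.choose j * (n - j).choose k := by
  have h1 := Nat.choose_mul (n := n) (k := j + k) (s := k) (by omega)
  have h2 := Nat.choose_mul (n := n) (k := j + k) (s := j) (by omega)
  rw [Nat.add_sub_cancel] at h1
  rw [Nat.add_sub_cancel_left] at h2
  rw [← h1, ← h2, Nat.choose_symm_add]

lemma alt_sum (d : ℕ) :
    ∑ k ∈ range (d + 1), ((d.choose k : ℝ) * (-1) ^ (d - k)) * ((k : ℝ) ^ d / k) =
      if d = 1 then 1 else 0 := by
  rcases d with _ | _ | d
  · simp
  · simp [sum_range_succ]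
  · have h := congrFun (fwdDiff_iter_pow_eq_zero_of_lt (R := ℝ) (show d + 1 < d + 2 by omega)) 0
    rw [fwdDiff_iter_eq_sum_shift] at h
    simp only [show d + 1 + 1 = d + 2 from rfl]
    rw [if_neg (by omega)]
    rw [Pi.zero_apply] at h
    rw [← h]
    refine sum_congr rfl fun k _ => ?_
    have : (k : ℝ) ^ (d + 2) / k = (k : ℝ) ^ (d + 1) := by
      rcases eq_or_ne k 0 with rfl | hk
      · simp
      · field_simp
        ring
    rw [this]
    simp only [zsmul_eq_mul, zero_add, nsmul_eq_mul, mul_one]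
    push_cast
    ring

lemma abel_identity (n : ℕ) (hn : 1 ≤ n) :
    ∑ k ∈ range (n + 1), (n.choose k : ℝ) * ((k : ℝ) ^ k / k) * ((n - k : ℕ) : ℝ) ^ (n - k) =
      (n : ℝ) ^ n := by
  have e : ∀ k ∈ range (n + 1),
      (n.choose k : ℝ) * ((k : ℝ) ^ k / k) * ((n - k : ℕ) : ℝ) ^ (n - k) =
      ∑ j ∈ range (n + 1), (n : ℝ) ^ j * (n.choose j : ℝ) *
        ((((n - j).choose k : ℝ) * (-1) ^ (n - j - k)) * ((k : ℝ) ^ (n - j) / k)) := by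
    intro k hk
    have hk' : k ≤ n := by simpa [Nat.lt_succ_iff] using hk
    rw [Nat.cast_sub hk', sub_eq_add_neg, add_pow, mul_sum]
    have : range (n - k + 1) ⊆ range (n + 1) := range_mono (by omega)
    rw [← sum_subset this]
    · refine sum_congr rfl fun j hj => ?_
      have hj' : j ≤ n - k := by simpa [Nat.lt_succ_iff] using hj
      have hc : (n.choose k : ℝ) * ((n - k).choose j : ℝ) = n.choose j * (n - j).choose k := by
        exact_mod_cast choose_swap n j k
      have e1 : n - k - j = n - j - k := by omega
      have e2 : (k : ℝ) ^ (n - j) = k ^ k * k ^ (n - j - k) := by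
        rw [← pow_add]; congr 1; omega
      rw [e1, e2, neg_pow]
      calc _ = ((n.choose k : ℝ) * ((n - k).choose j : ℝ)) * ((k : ℝ) ^ k / k) *
            ((n : ℝ) ^ j * ((-1) ^ (n - j - k) * (k : ℝ) ^ (n - j - k))) := by ring
        _ = _ := by rw [hc]; ring
    · intro j hj0 hj
      have hj' : n - k < j := by simpa [Nat.lt_succ_iff] using hj
      rw [Nat.choose_eq_zero_of_lt (show n - j < k by simp at hj0; omega)]
      simp
  rw [sum_congr rfl e, sum_comm]
  have e3 : ∀ j ∈ range (n + 1), ∑ k ∈ range (n + 1), (n : ℝ) ^ j * (n.choose j : ℝ) *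
        ((((n - j).choose k : ℝ) * (-1) ^ (n - j - k)) * ((k : ℝ) ^ (n - j) / k)) =
      if j = n - 1 then (n : ℝ) ^ j * (n.choose j : ℝ) else 0 := by
    intro j hj
    have hj' : j ≤ n := by simpa [Nat.lt_succ_iff] using hj
    rw [← mul_sum]
    have : range (n - j + 1) ⊆ range (n + 1) := range_mono (by omega)
    rw [← sum_subset this, alt_sum]
    · by_cases h : j = n - 1
      · rw [if_pos (by omega), if_pos h, mul_one]
      · rw [if_neg (by omega), if_neg h, mul_zero]
    · intro k _ hk
      rw [Nat.choose_eq_zero_of_lt (by simpa [Nat.lt_succ_iff] using hk)]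
      simp
  rw [sum_congr rfl e3, sum_ite_eq' , if_pos (by simp)]
  obtain ⟨n, rfl⟩ := Nat.exists_eq_add_of_le' hn
  simp [pow_succ]

open PowerSeries in
noncomputable def BS : PowerSeries ℝ := PowerSeries.mk fun k => (k : ℝ) ^ k / (k.factorial : ℝ)

noncomputable def TS : PowerSeries ℝ :=
  PowerSeries.mk fun k => ((k : ℝ) ^ k / k) / (k.factorial : ℝ)

lemma BT : BS * TS = BS - 1 := by
  ext n
  rw [mul_comm, PowerSeries.coeff_mul, Finset.Nat.sum_antidiagonal_eq_sum_range_succ_mk]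
  rcases Nat.eq_zero_or_pos n with rfl | hn
  · simp [BS, TS]
  · have h := abel_identity n hn
    simp only [map_sub, PowerSeries.coeff_one, if_neg hn.ne', BS, TS, PowerSeries.coeff_mk, sub_zero]
    rw [← h, sum_div]
    refine sum_congr rfl fun k hk => ?_
    have hk' : k ≤ n := by simpa [Nat.lt_succ_iff] using hk
    rw [Nat.cast_choose ℝ hk']
    have : (n.factorial : ℝ) ≠ 0 := by positivity
    field_simp

open PowerSeries in
lemma XT : (X : PowerSeries ℝ) * derivative ℝ TS = BS - 1 := by
  ext n
  rcases n with _ | n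
  · simp [BS]
  · rw [coeff_succ_X_mul, coeff_derivative]
    simp only [map_sub, PowerSeries.coeff_one, BS, TS, PowerSeries.coeff_mk]
    rw [if_neg (by omega)]
    have : (n : ℝ) + 1 ≠ 0 := by positivity
    push_cast
    field_simp
    simp

open PowerSeries in
lemma XB : (X : PowerSeries ℝ) * derivative ℝ BS = BS ^ 3 - BS ^ 2 := by
  have h := congrArg (derivative ℝ) BT
  simp only [Derivation.leibniz, smul_eq_mul, map_sub, Derivation.map_one_eq_zero, sub_zero] at h
  have h2 := XT
  have h3 := BT
  set B := BS
  set T := TS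
  have e : X * derivative ℝ B * (1 - T) = B * (B - 1) := by
    rw [← h2]; linear_combination (-X) * h
  have e1 : B * (1 - T) = 1 := by linear_combination -h3
  linear_combination B * e - X * derivative ℝ B * e1

open PowerSeries in
lemma BS_rec (m n : ℕ) (hm : 1 ≤ m) :
    coeff n (BS ^ (m + 2)) = coeff n (BS ^ (m + 1)) + (n / m : ℝ) * coeff n (BS ^ m) := by
  have h : (X : PowerSeries ℝ) * derivative ℝ (BS ^ m) = m * (BS ^ (m + 2) - BS ^ (m + 1)) := by
    rw [derivative_pow]
    have := XB
    obtain ⟨m, rfl⟩ := Nat.exists_eq_add_of_le' hm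
    simp only [Nat.add_sub_cancel]
    linear_combination ((m + 1 : ℕ) : PowerSeries ℝ) * BS ^ m * this
  have h2 := congrArg (coeff n) h
  have e : coeff n (X * derivative ℝ (BS ^ m)) = n * coeff n (BS ^ m) := by
    rcases n with _ | n
    · simp
    · rw [coeff_succ_X_mul, coeff_derivative]; push_cast; ring
  have e2 : coeff n ((m : PowerSeries ℝ) * (BS ^ (m + 2) - BS ^ (m + 1))) =
      m * (coeff n (BS ^ (m + 2)) - coeff n (BS ^ (m + 1))) := by
    rw [← nsmul_eq_mul, map_nsmul, nsmul_eq_mul, map_sub]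
  rw [e, e2] at h2
  have : (m : ℝ) ≠ 0 := by positivity
  field_simp
  linarith

open PowerSeries in
lemma BS_pow_coeff (m n : ℕ) :
    coeff n (BS ^ m) = ∑ ν ∈ Finset.Nat.antidiagonalTuple m n,
      ∏ i, ((ν i : ℝ) ^ (ν i) / ((ν i).factorial : ℝ)) := by
  have : BS ^ m = ∏ _i : Fin m, BS := by simp
  rw [this, coeff_prod, ← piAntidiag_univ_fin_eq_antidiagonalTuple]
  refine sum_bij (fun f _ => (f : Fin m → ℕ)) ?_ ?_ ?_ ?_
  · intro f hf; simpa using hf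
  · intro f _ g _ h; exact DFunLike.coe_injective h
  · intro f hf
    refine ⟨Finsupp.equivFunOnFinite.symm f, ?_, ?_⟩
    · simpa using hf
    · simp
  · intro f _; simp [BS]
open PowerSeries in
lemma BS_two (N : ℕ) : coeff (N + 1) (BS ^ 2) =
    2 * (((N + 1 : ℕ) : ℝ) ^ (N + 1) / ((N + 1).factorial : ℝ)) +
    ∑ k ∈ range N, (((k + 1 : ℕ) : ℝ) ^ (k + 1) / ((k + 1).factorial : ℝ)) *
      (((N - k : ℕ) : ℝ) ^ (N - k) / ((N - k).factorial : ℝ)) := by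
  rw [pow_two, PowerSeries.coeff_mul, Finset.Nat.sum_antidiagonal_eq_sum_range_succ_mk,
    sum_range_succ, sum_range_succ']
  simp only [BS, coeff_mk]
  rw [Nat.sub_self, Nat.sub_zero]
  have : ∀ k, N + 1 - (k + 1) = N - k := by intro k; omega
  simp only [this]
  norm_num
  ring

lemma sum_inv_sqrt (N : ℕ) : ∑ k ∈ range N, 1 / Real.sqrt ((k + 1 : ℕ) : ℝ) ≤ 2 * Real.sqrt N := by
  induction N with
  | zero => simp
  | succ N ih =>
    rw [sum_range_succ]
    have hs : 0 < Real.sqrt ((N + 1 : ℕ) : ℝ) := Real.sqrt_pos.2 (by positivity)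
    have h0 := Real.sqrt_nonneg (N : ℝ)
    have q1 := Real.sq_sqrt (show (0:ℝ) ≤ ((N + 1 : ℕ) : ℝ) by positivity)
    have q2 := Real.sq_sqrt (show (0:ℝ) ≤ (N : ℝ) by positivity)
    suffices 1 / Real.sqrt ((N + 1 : ℕ) : ℝ) ≤ 2 * Real.sqrt ((N + 1 : ℕ) : ℝ) - 2 * Real.sqrt N by
      linarith
    rw [div_le_iff₀ hs]
    push_cast at *
    nlinarith [sq_nonneg (Real.sqrt ((N : ℝ) + 1) - Real.sqrt N)]

lemma b_le (k : ℕ) (hk : 1 ≤ k) : (k : ℝ) ^ k / (k.factorial : ℝ) ≤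
    Real.exp 1 ^ k / (Real.sqrt (2 * Real.pi) * Real.sqrt k) := by
  have h := Stirling.le_factorial_stirling k
  have hk0 : (0:ℝ) < k := by exact_mod_cast hk
  have : 0 < Real.sqrt (2 * Real.pi) := by positivity
  have : 0 < Real.sqrt k := by positivity
  rw [Real.sqrt_mul (by positivity), div_pow] at h
  rw [div_le_div_iff₀ (by positivity) (by positivity)]
  have he : 0 < Real.exp 1 ^ k := by positivity
  calc _ = (Real.sqrt (2 * Real.pi) * Real.sqrt k * ((k : ℝ) ^ k / Real.exp 1 ^ k)) *
      Real.exp 1 ^ k := by field_simp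
    _ ≤ (k.factorial : ℝ) * Real.exp 1 ^ k := by gcongr
    _ = _ := by ring

lemma fact_le (n : ℕ) (hn : 1 ≤ n) : (n.factorial : ℝ) / (n : ℝ) ^ n ≤
    Real.exp 1 * Real.sqrt n / Real.exp 1 ^ n := by
  have h := Stirling.stirlingSeq'_antitone (Nat.zero_le (n - 1))
  simp only [Function.comp, Nat.succ_eq_add_one, Nat.sub_add_cancel hn, zero_add,
    Stirling.stirlingSeq_one] at h
  unfold Stirling.stirlingSeq at h
  have hn0 : (0:ℝ) < n := by exact_mod_cast hn
  have : 0 < Real.sqrt n := by positivity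
  have h2 : 0 < Real.sqrt 2 := by positivity
  rw [Real.sqrt_mul (by positivity), div_pow, div_le_div_iff₀ (by positivity) h2] at h
  have h' : (n.factorial : ℝ) ≤ Real.exp 1 * (Real.sqrt n * ((n : ℝ) ^ n / Real.exp 1 ^ n)) := by
    refine le_of_mul_le_mul_right ?_ h2
    linarith
  rw [div_le_iff₀ (by positivity)]
  refine h'.trans (le_of_eq ?_)
  ring

open PowerSeries in
lemma A_two (n : ℕ) (hn : 100 ≤ n) :
    (n.factorial : ℝ) / (n : ℝ) ^ n * coeff n (BS ^ 2) ≤ 2 + 1.733 * Real.sqrt n := by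
  obtain ⟨N, rfl⟩ := Nat.exists_eq_add_of_le' (show 1 ≤ n by omega)
  rw [BS_two, mul_add, mul_sum]
  set n := N + 1 with hnN
  have hn0 : (0:ℝ) < n := by positivity
  have hr : 0 < Real.sqrt n := by positivity
  have e1 : (n.factorial : ℝ) / (n : ℝ) ^ n * (2 * ((n : ℝ) ^ n / (n.factorial : ℝ))) = 2 := by
    have : (n.factorial : ℝ) ≠ 0 := by positivity
    field_simp
  rw [e1]
  have hpi := Real.pi_pos
  have hterm : ∀ k ∈ range N, (n.factorial : ℝ) / (n : ℝ) ^ n *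
      ((((k + 1 : ℕ) : ℝ) ^ (k + 1) / ((k + 1).factorial : ℝ)) *
      (((N - k : ℕ) : ℝ) ^ (N - k) / ((N - k).factorial : ℝ))) ≤
      Real.exp 1 / (2 * Real.pi) * (1 / Real.sqrt ((k + 1 : ℕ) : ℝ) +
        1 / Real.sqrt ((N - 1 - k + 1 : ℕ) : ℝ)) := by
    intro k hk
    have hk' : k < N := by simpa using hk
    have ej : N - 1 - k + 1 = N - k := by omega
    rw [ej]
    obtain ⟨a, ha⟩ : ∃ a, a = k + 1 := ⟨_, rfl⟩
    obtain ⟨b, hb⟩ : ∃ b, b = N - k := ⟨_, rfl⟩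
    have hab : n = a + b := by omega
    rw [← ha, ← hb]
    have ha1 : 1 ≤ a := by omega
    have hb1 : 1 ≤ b := by omega
    have ha0 : (0:ℝ) < a := by exact_mod_cast ha1
    have hb0 : (0:ℝ) < b := by exact_mod_cast hb1
    have sa : 0 < Real.sqrt a := by positivity
    have sb : 0 < Real.sqrt b := by positivity
    have s2 : 0 < Real.sqrt (2 * Real.pi) := by positivity
    have tri : Real.sqrt n ≤ Real.sqrt a + Real.sqrt b := by
      rw [Real.sqrt_le_left (by positivity)]
      have q1 := Real.sq_sqrt ha0.le
      have q2 := Real.sq_sqrt hb0.le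
      rw [hab]; push_cast
      nlinarith [mul_pos sa sb]
    calc _ ≤ (Real.exp 1 * Real.sqrt n / Real.exp 1 ^ n) *
          ((Real.exp 1 ^ a / (Real.sqrt (2 * Real.pi) * Real.sqrt a)) *
            (Real.exp 1 ^ b / (Real.sqrt (2 * Real.pi) * Real.sqrt b))) := by
          exact mul_le_mul (fact_le n (by omega))
            (mul_le_mul (b_le a ha1) (b_le b hb1) (by positivity) (by positivity))
            (by positivity) (by positivity)
      _ = Real.exp 1 / (Real.sqrt (2 * Real.pi) ^ 2) *
            (Real.sqrt n / (Real.sqrt a * Real.sqrt b)) := by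
          have : Real.exp 1 ^ n = Real.exp 1 ^ a * Real.exp 1 ^ b := by rw [hab, pow_add]
          rw [this]
          field_simp
      _ ≤ Real.exp 1 / (Real.sqrt (2 * Real.pi) ^ 2) *
            ((Real.sqrt a + Real.sqrt b) / (Real.sqrt a * Real.sqrt b)) := by
          gcongr
      _ = _ := by
          rw [Real.sq_sqrt (by positivity)]
          field_simp
          ring
  have hsum := sum_le_sum hterm
  rw [← mul_sum (range N) _ (Real.exp 1 / (2 * Real.pi)), sum_add_distrib,
    Finset.sum_range_reflect (fun k => 1 / Real.sqrt ((k + 1 : ℕ) : ℝ)) N] at hsum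
  have h3 := sum_inv_sqrt N
  have h4 : Real.sqrt N ≤ Real.sqrt n := Real.sqrt_le_sqrt (by rw [hnN]; push_cast; linarith)
  have h5 : Real.exp 1 / (2 * Real.pi) * (∑ k ∈ range N, 1 / Real.sqrt ((k + 1 : ℕ) : ℝ) +
      ∑ k ∈ range N, 1 / Real.sqrt ((k + 1 : ℕ) : ℝ)) ≤
      Real.exp 1 / (2 * Real.pi) * (4 * Real.sqrt n) := by
    gcongr; linarith
  have h6 : Real.exp 1 / (2 * Real.pi) ≤ 1.733 / 4 := by
    rw [div_le_iff₀ (by positivity)]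
    linarith [Real.exp_one_lt_d9, Real.pi_gt_d4]
  have h7 := mul_le_mul_of_nonneg_right h6 (show 0 ≤ 4 * Real.sqrt n by positivity)
  linarith

open PowerSeries in
lemma A_bound (n : ℕ) (hn : 100 ≤ n) (m : ℕ) (hm : 2 ≤ m) :
    Real.sqrt n * ((n.factorial : ℝ) / (n : ℝ) ^ n * coeff n (BS ^ m)) <
      10 * 0.6 ^ m * Real.sqrt n ^ m := by
  obtain ⟨A, hA⟩ : ∃ A : ℕ → ℝ,
    A = fun m => (n.factorial : ℝ) / (n : ℝ) ^ n * coeff n (BS ^ m) := ⟨_, rfl⟩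
  have h2 : A 2 ≤ 2 + 1.733 * Real.sqrt n := by rw [hA]; exact A_two n hn
  have hn0 : (0:ℝ) < n := by positivity
  have h1 : A 1 = 1 := by
    have : (n.factorial : ℝ) ≠ 0 := by positivity
    simp only [hA, pow_one, BS, coeff_mk]
    field_simp
  have hrec : ∀ m, 1 ≤ m → A (m + 2) = A (m + 1) + (n / m : ℝ) * A m := by
    intro m hm
    simp only [hA]; rw [BS_rec m n hm]; ring
  have hpos : ∀ m, 0 ≤ A m := by
    intro m; simp only [hA]; rw [BS_pow_coeff]; positivity
  suffices Real.sqrt n * A m < 10 * 0.6 ^ m * Real.sqrt n ^ m by simpa [hA] using this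
  obtain ⟨r, hr⟩ : ∃ r, r = Real.sqrt n := ⟨_, rfl⟩
  have hnr : (n : ℝ) = r ^ 2 := by rw [hr, Real.sq_sqrt hn0.le]
  have hr10 : 10 ≤ r := by
    rw [hr]; apply Real.le_sqrt_of_sq_le
    have : (100:ℝ) ≤ n := by exact_mod_cast hn
    linarith
  rw [← hr] at h2 ⊢
  have hr0 : 0 < r := by linarith
  have a2 : A 2 ≤ 1.933 * r := by linarith
  have r2 : 10 * r ≤ r ^ 2 := by nlinarith
  have r3 : 10 * r ^ 2 ≤ r ^ 3 := by nlinarith [sq_nonneg r]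
  have r4 : 10 * r ^ 3 ≤ r ^ 4 := by nlinarith [pow_pos hr0 3]
  have a3 : A 3 ≤ 1.2 * r ^ 2 := by
    have := hrec 1 le_rfl
    norm_num [h1] at this
    rw [this, hnr]; linarith
  have a4 : A 4 ≤ 1.1 * r ^ 3 := by
    have := hrec 2 (by norm_num)
    norm_num at this
    rw [this, hnr]
    have := mul_le_mul_of_nonneg_left a2 (show 0 ≤ r ^ 2 / 2 by positivity)
    nlinarith [pow_pos hr0 3]
  have a5 : A 5 ≤ 0.6 * r ^ 4 := by
    have := hrec 3 (by norm_num)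
    norm_num at this
    rw [this, hnr]
    have := mul_le_mul_of_nonneg_left a3 (show 0 ≤ r ^ 2 / 3 by positivity)
    nlinarith [pow_pos hr0 4]
  have key : ∀ j, r * A (j + 4) < 10 * 0.6 ^ (j + 4) * r ^ (j + 4) ∧
      r * A (j + 5) < 10 * 0.6 ^ (j + 5) * r ^ (j + 5) := by
    intro j
    induction j with
    | zero =>
      have p4 := pow_pos hr0 4
      have p5 := pow_pos hr0 5
      constructor
      · have := mul_le_mul_of_nonneg_left a4 hr0.le
        norm_num at this ⊢; nlinarith
      · have := mul_le_mul_of_nonneg_left a5 hr0.le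
        norm_num at this ⊢; nlinarith
    | succ j ih =>
      obtain ⟨i1, i2⟩ := ih
      refine ⟨by simpa [add_assoc, add_comm, add_left_comm] using i2, ?_⟩
      have e := hrec (j + 4) (by omega)
      have e' : A (j + 1 + 5) = A (j + 5) + (n / ((j + 4 : ℕ) : ℝ)) * A (j + 4) := e
      have l : (n / ((j + 4 : ℕ) : ℝ)) * A (j + 4) ≤ r ^ 2 / 4 * A (j + 4) := by
        apply mul_le_mul_of_nonneg_right _ (hpos _)
        rw [hnr]
        apply div_le_div_of_nonneg_left (by positivity) (by norm_num)
        push_cast; linarith [(Nat.cast_nonneg j : (0:ℝ) ≤ j)]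
      rw [e']
      have l' := mul_le_mul_of_nonneg_left l hr0.le
      have i1' := mul_le_mul_of_nonneg_left i1.le (show 0 ≤ r ^ 2 / 4 by positivity)
      set G := 10 * 0.6 ^ (j + 4) * r ^ (j + 4) with hG
      have hG0 : 0 < G := by positivity
      have g1 : 10 * 0.6 ^ (j + 5) * r ^ (j + 5) = 0.6 * r * G := by rw [hG]; ring
      have g2 : 10 * 0.6 ^ (j + 1 + 5) * r ^ (j + 1 + 5) = 0.36 * r ^ 2 * G := by rw [hG]; ring
      rw [g1] at i2
      rw [g2]
      have : 0.6 * r * G + r ^ 2 / 4 * G ≤ 0.36 * r ^ 2 * G := by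
        have := mul_le_mul_of_nonneg_right (show 0.6 * r + r ^ 2 / 4 ≤ 0.36 * r ^ 2 by linarith) hG0.le
        linarith
      linarith
  rcases (show m = 2 ∨ m = 3 ∨ ∃ j, m = j + 4 by
    rcases Nat.lt_or_ge m 4 with h | h
    · omega
    · exact Or.inr (Or.inr ⟨m - 4, by omega⟩)) with rfl | rfl | ⟨j, rfl⟩
  · have := mul_le_mul_of_nonneg_left a2 hr0.le
    norm_num at this ⊢; nlinarith [pow_pos hr0 2]
  · have := mul_le_mul_of_nonneg_left a3 hr0.le
    norm_num at this ⊢; nlinarith [pow_pos hr0 3]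
  · exact (key j).1

lemma multinomial_eq_exp {m : ℕ} (n : ℕ) (hn : 1 ≤ n) (ν : Fin m → ℕ) (hν : ∑ i, ν i = n) :
    (Nat.multinomial Finset.univ ν : ℝ) =
      (n.factorial : ℝ) / (n : ℝ) ^ n * (∏ i, ((ν i : ℝ) ^ (ν i) / ((ν i).factorial : ℝ))) *
      Real.exp (n * -∑ i, (ν i : ℝ) / n * Real.log ((ν i : ℝ) / n)) := by
  have hn0 : (0:ℝ) < n := by exact_mod_cast hn
  have hspec : (∏ i, ((ν i).factorial : ℝ)) * (Nat.multinomial Finset.univ ν : ℝ) = n.factorial := by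
    have := Nat.multinomial_spec Finset.univ ν
    rw [hν] at this
    exact_mod_cast this
  have hexp : (∏ i, (ν i : ℝ) ^ (ν i)) *
      Real.exp (n * -∑ i, (ν i : ℝ) / n * Real.log ((ν i : ℝ) / n)) = (n : ℝ) ^ n := by
    have : (n * -∑ i, (ν i : ℝ) / n * Real.log ((ν i : ℝ) / n)) =
        ∑ i, -((ν i : ℝ) * Real.log ((ν i : ℝ) / n)) := by
      rw [← sum_neg_distrib, mul_sum]
      refine sum_congr rfl fun i _ => ?_
      field_simp
    rw [this, Real.exp_sum, ← prod_mul_distrib]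
    have h2 : ∀ i ∈ univ, (ν i : ℝ) ^ (ν i) * Real.exp (-((ν i : ℝ) * Real.log ((ν i : ℝ) / n))) =
        (n : ℝ) ^ (ν i) := by
      intro i _
      rcases Nat.eq_zero_or_pos (ν i) with h | h
      · simp [h]
      · have h0 : (0:ℝ) < ν i := by exact_mod_cast h
        rw [Real.exp_neg, Real.exp_nat_mul, Real.exp_log (by positivity), div_pow]
        field_simp
    rw [prod_congr rfl h2, prod_pow_eq_pow_sum, hν]
  have hP : (∏ i, ((ν i).factorial : ℝ)) ≠ 0 := by
    apply prod_ne_zero_iff.2; intro i _; positivity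
  rw [prod_div_distrib]
  calc (Nat.multinomial Finset.univ ν : ℝ)
      = n.factorial / (∏ i, ((ν i).factorial : ℝ)) := by
        rw [eq_div_iff hP, ← hspec]; ring
    _ = (n.factorial : ℝ) / (n : ℝ) ^ n * ((n : ℝ) ^ n / (∏ i, ((ν i).factorial : ℝ))) := by
        field_simp
    _ = _ := by rw [← hexp]; ring


/-- Let `C` be a convex set of probability vectors, `φ*` an entropy
maximizer over `C` with `H* = H(φ*)`, and `0 < θ ≤ 1/2`. For every `n ≥ 100`, the
total number of realizations of frequency vectors `f ∈ F_n ∩ C` with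
`‖f − φ*‖₁ > θ` is strictly less than
`4.004·√(2π)·0.6^m·n^{(m−1)/2}·e^{n(H*−θ²/2)}`. -/
theorem stmt_13 (m : ℕ) (hm : 2 ≤ m) (C : Set (Fin m → ℝ))
    (hCprob : ∀ x ∈ C, (∀ i, 0 ≤ x i) ∧ ∑ i, x i = 1)
    (hCconv : Convex ℝ C)
    (φ : Fin m → ℝ) (hφC : φ ∈ C)
    (hφmax : ∀ x ∈ C, -∑ i, x i * Real.log (x i) ≤ -∑ i, φ i * Real.log (φ i))
    (Hs : ℝ) (hHs : Hs = -∑ i, φ i * Real.log (φ i))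
    (θ : ℝ) (hθ0 : 0 < θ) (hθ : θ ≤ 1 / 2)
    (n : ℕ) (hn : 100 ≤ n) :
    (∑ ν ∈ (Finset.Nat.antidiagonalTuple m n).filter
        (fun ν => (fun i => (ν i : ℝ) / n) ∈ C ∧ (∑ i, |(ν i : ℝ) / n - φ i|) > θ),
        (Nat.multinomial Finset.univ ν : ℝ)) <
      4.004 * Real.sqrt (2 * Real.pi) * 0.6 ^ m * (n : ℝ) ^ (((m : ℝ) - 1) / 2) *
        Real.exp (n * (Hs - θ ^ 2 / 2)) := by
  have hn0 : (0:ℝ) < n := by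
    have : 0 < n := by omega
    exact_mod_cast this
  set E := Real.exp (n * (Hs - θ ^ 2 / 2)) with hE
  have hE0 : 0 < E := Real.exp_pos _
  have step1 : (∑ ν ∈ (Finset.Nat.antidiagonalTuple m n).filter
        (fun ν => (fun i => (ν i : ℝ) / n) ∈ C ∧ (∑ i, |(ν i : ℝ) / n - φ i|) > θ),
        (Nat.multinomial Finset.univ ν : ℝ)) ≤
      (n.factorial : ℝ) / (n : ℝ) ^ n * PowerSeries.coeff n (BS ^ m) * E := by
    rw [BS_pow_coeff, mul_sum, sum_mul]
    refine le_trans (sum_le_sum (g := fun ν => (n.factorial : ℝ) / (n : ℝ) ^ n *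
      (∏ i, ((ν i : ℝ) ^ (ν i) / ((ν i).factorial : ℝ))) * E) ?_) ?_
    · intro ν hν
      rw [mem_filter, Finset.Nat.mem_antidiagonalTuple] at hν
      obtain ⟨hs, hC, hθν⟩ := hν
      rw [multinomial_eq_exp n (by omega) ν hs]
      have gap := entropy_gap C hCprob hCconv φ hφC hφmax _ hC
      have : θ ^ 2 ≤ (∑ i, |(ν i : ℝ) / n - φ i|) ^ 2 := by gcongr
      apply mul_le_mul_of_nonneg_left _ (by positivity)
      rw [hE]
      apply Real.exp_le_exp.2
      apply mul_le_mul_of_nonneg_left _ hn0.le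
      linarith
    · apply sum_le_sum_of_subset_of_nonneg (filter_subset _ _)
      intro ν _ _
      positivity
  refine lt_of_le_of_lt step1 ?_
  apply mul_lt_mul_of_pos_right _ hE0
  have hb := A_bound n hn m hm
  have hr : 0 < Real.sqrt n := Real.sqrt_pos.2 hn0
  have hpow : (n : ℝ) ^ (((m : ℝ) - 1) / 2) = Real.sqrt n ^ m / Real.sqrt n := by
    rw [eq_div_iff hr.ne', ← Real.rpow_natCast, Real.sqrt_eq_rpow, ← Real.rpow_mul hn0.le,
      ← Real.rpow_add hn0]
    congr 1; ring
  rw [hpow]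
  have hK : (10:ℝ) ≤ 4.004 * Real.sqrt (2 * Real.pi) := by
    have : (2.5:ℝ) ≤ Real.sqrt (2 * Real.pi) := by
      apply Real.le_sqrt_of_sq_le
      linarith [Real.pi_gt_d2]
    linarith
  have h10 : (n.factorial : ℝ) / (n : ℝ) ^ n * PowerSeries.coeff n (BS ^ m) <
      10 * 0.6 ^ m * (Real.sqrt n ^ m / Real.sqrt n) := by
    rw [← mul_div_assoc, lt_div_iff₀ hr]
    linarith
  refine h10.trans_le ?_
  gcongr
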